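/- Let N ≥ 3 be an integer, let a, b > −2 and p, q > 0 with pq > 1. Then there exists a constant C > 0, depending only on N, p, q, a, b, such that every positive solution (u, v) of the Hardy–Hénon system on ℝ^N satisfies, for all R > 0, ∫_{R/2 < |x| < R} |x|^a v(x)^p dx ≤ C R^{N − 2 − α − (a+bp)/(pq−1)} and ∫_{R/2 < |x| < R} |x|^b u(x)^q dx ≤ C R^{N − 2 − β − (b+aq)/(pq−1)}. -/

import Mathlib

open MeasureTheory Metric Set Filter

/-- The Euclidean Laplacian of `u : ℝ^N → ℝ`, as the sum of the second derivatives
along the standard coordinate directions. -/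
noncomputable def lap {N : ℕ} (u : EuclideanSpace ℝ (Fin N) → ℝ)
    (x : EuclideanSpace ℝ (Fin N)) : ℝ :=
  ∑ i : Fin N, iteratedFDeriv ℝ 2 u x ![EuclideanSpace.single i 1, EuclideanSpace.single i 1]

/-- `(u, v)` is a positive solution of the Hardy–Hénon system
`-Δu = |x|^a v^p`, `-Δv = |x|^b u^q` on the set `Ω`:
`u, v` are continuous on `Ω`, `C²` on `Ω \ {0}`, positive on `Ω`, and
the equations hold on `Ω \ {0}`. -/
def IsHHSol {N : ℕ} (a b p q : ℝ) (Ω : Set (EuclideanSpace ℝ (Fin N)))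
    (u v : EuclideanSpace ℝ (Fin N) → ℝ) : Prop :=
  ContinuousOn u Ω ∧ ContinuousOn v Ω ∧
  ContDiffOn ℝ 2 u (Ω \ {0}) ∧ ContDiffOn ℝ 2 v (Ω \ {0}) ∧
  (∀ x ∈ Ω, 0 < u x) ∧ (∀ x ∈ Ω, 0 < v x) ∧
  (∀ x ∈ Ω \ {0}, -lap u x = ‖x‖ ^ a * v x ^ p) ∧
  (∀ x ∈ Ω \ {0}, -lap v x = ‖x‖ ^ b * u x ^ q)

section Domains

variable {N : ℕ}

theorem isOpen_univ_sdiff_zero : IsOpen (univ \ {0} : Set (EuclideanSpace ℝ (Fin N))) := by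
  simp [← compl_eq_univ_sdiff]

theorem isOpen_annulus (r R : ℝ) :
    IsOpen {x : EuclideanSpace ℝ (Fin N) | r < ‖x‖ ∧ ‖x‖ < R} :=
  (isOpen_lt continuous_const continuous_norm).inter (isOpen_lt continuous_norm continuous_const)

theorem isCompact_annulus (r R : ℝ) :
    IsCompact {x : EuclideanSpace ℝ (Fin N) | r ≤ ‖x‖ ∧ ‖x‖ ≤ R} :=
  (isCompact_closedBall (0 : EuclideanSpace ℝ (Fin N)) R).of_isClosed_subset
    ((isClosed_le continuous_const continuous_norm).inter
      (isClosed_le continuous_norm continuous_const)) fun x hx => by simpa using hx.2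

end Domains

section Laplacian

variable {N : ℕ}

theorem lap_eq_sum_fderiv {u : EuclideanSpace ℝ (Fin N) → ℝ} {x : EuclideanSpace ℝ (Fin N)}
    (hu : ContDiffAt ℝ 2 u x) :
    lap u x = ∑ i : Fin N, fderiv ℝ (fun y => fderiv ℝ u y (EuclideanSpace.single i 1)) x
      (EuclideanSpace.single i 1) := by
  have h : DifferentiableAt ℝ (fderiv ℝ u) x :=
    (hu.fderiv_right (m := 1) (by norm_num)).differentiableAt (by norm_num)
  refine Finset.sum_congr rfl fun i _ => ?_
  rw [iteratedFDeriv_two_apply, fderiv_clm_apply h (by fun_prop)]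
  simp

theorem lap_congr {u w : EuclideanSpace ℝ (Fin N) → ℝ} {x : EuclideanSpace ℝ (Fin N)}
    (h : u =ᶠ[nhds x] w) : lap u x = lap w x := by
  unfold lap
  rw [(h.iteratedFDeriv ℝ 2).eq_of_nhds]

theorem continuous_lap {u : EuclideanSpace ℝ (Fin N) → ℝ} (hu : ContDiff ℝ 2 u) :
    Continuous (lap u) := by
  have h := hu.continuous_iteratedFDeriv (m := 2) le_rfl
  unfold lap
  fun_prop

theorem continuousOn_lap {u : EuclideanSpace ℝ (Fin N) → ℝ} {s : Set (EuclideanSpace ℝ (Fin N))}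
    (hs : IsOpen s) (hu : ContDiffOn ℝ 2 u s) : ContinuousOn (lap u) s := by
  have h : ContinuousOn (iteratedFDeriv ℝ 2 u) s :=
    (hu.continuousOn_iteratedFDerivWithin (m := 2) le_rfl hs.uniqueDiffOn).congr
      fun x hx => (iteratedFDerivWithin_of_isOpen 2 hs hx).symm
  exact continuousOn_finsetSum _ fun i _ =>
    (ContinuousMultilinearMap.apply ℝ (fun _ : Fin 2 => EuclideanSpace ℝ (Fin N)) ℝ
      ![EuclideanSpace.single i 1, EuclideanSpace.single i 1]).continuous.comp_continuousOn h

theorem lap_sub_const_mul {u w : EuclideanSpace ℝ (Fin N) → ℝ} {x : EuclideanSpace ℝ (Fin N)}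
    (hu : ContDiffAt ℝ 2 u x) (hw : ContDiffAt ℝ 2 w x) (s : ℝ) :
    lap (fun y => u y - s * w y) x = lap u x - s * lap w x := by
  have h : iteratedFDeriv ℝ 2 (u - s • w) x
      = iteratedFDeriv ℝ 2 u x - s • iteratedFDeriv ℝ 2 w x := by
    rw [iteratedFDeriv_sub_apply (g := s • w) hu (hw.const_smul s), iteratedFDeriv_const_smul_apply hw]
  have h' : (fun y => u y - s * w y) = u - s • w := rfl
  unfold lap
  rw [h', h, Finset.mul_sum, ← Finset.sum_sub_distrib]
  simp

theorem lap_comp_smul {u : EuclideanSpace ℝ (Fin N) → ℝ} {x : EuclideanSpace ℝ (Fin N)} {R : ℝ}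
    (hu : ContDiffAt ℝ 2 u (R • x)) :
    lap (fun y => u (R • y)) x = R ^ 2 * lap u (R • x) := by
  have hR : ContDiffAt ℝ 2 (fun y => u (R • y)) x :=
    ContDiffAt.comp x hu (by fun_prop)
  rw [lap_eq_sum_fderiv hR, lap_eq_sum_fderiv hu, Finset.mul_sum]
  refine Finset.sum_congr rfl fun i _ => ?_
  simp only [fderiv_comp_smul]
  rw [← smul_eq_mul]
  have := fderiv_comp_smul (𝕜 := ℝ) (f := fun y => R • fderiv ℝ u y (EuclideanSpace.single i 1))
    (c := R) (x := x)
  simp only [smul_apply] at this ⊢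
  rw [this, smul_apply]
  have h : DifferentiableAt ℝ (fun y => fderiv ℝ u y (EuclideanSpace.single i 1)) (R • x) :=
    ((hu.fderiv_right (m := 1) (by norm_num)).differentiableAt (by norm_num)).clm_apply
      (by fun_prop)
  rw [fderiv_fun_const_smul h]
  simp [pow_two, mul_assoc]

theorem lap_comp {H : ℝ → ℝ} {u : EuclideanSpace ℝ (Fin N) → ℝ} (hH : ContDiff ℝ 2 H)
    (hu : ContDiff ℝ 2 u) (x : EuclideanSpace ℝ (Fin N)) :
    lap (fun y => H (u y)) x
      = deriv (deriv H) (u x) * ∑ i : Fin N, (fderiv ℝ u x (EuclideanSpace.single i 1)) ^ 2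
        + deriv H (u x) * lap u x := by
  have hd : Differentiable ℝ u := hu.differentiable (by norm_num)
  have hHd : Differentiable ℝ H := hH.differentiable (by norm_num)
  have hH' : Differentiable ℝ (deriv H) :=
    ((contDiff_succ_iff_deriv (n := 1)).1 hH).2.2.differentiable (by norm_num)
  have hHu : ContDiff ℝ 2 fun y => H (u y) := hH.comp hu
  rw [lap_eq_sum_fderiv hHu.contDiffAt, lap_eq_sum_fderiv hu.contDiffAt,
    Finset.mul_sum, Finset.mul_sum, ← Finset.sum_add_distrib]
  refine Finset.sum_congr rfl fun i _ => ?_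
  have h1 : ∀ y, HasFDerivAt (fun y => H (u y)) (deriv H (u y) • fderiv ℝ u y) y := fun y =>
    (hHd (u y)).hasDerivAt.comp_hasFDerivAt y (hd y).hasFDerivAt
  have h2 : HasFDerivAt (fun y => deriv H (u y)) (deriv (deriv H) (u x) • fderiv ℝ u x) x :=
    (hH' (u x)).hasDerivAt.comp_hasFDerivAt x (hd x).hasFDerivAt
  have h3 : DifferentiableAt ℝ (fun y => fderiv ℝ u y (EuclideanSpace.single i 1)) x :=
    ((hu.fderiv_right (m := 1) (by norm_num)).differentiable (by norm_num) x).clm_apply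
      (by fun_prop)
  have h4 : (fun y => fderiv ℝ (fun y => H (u y)) y (EuclideanSpace.single i 1))
      = fun y => deriv H (u y) * fderiv ℝ u y (EuclideanSpace.single i 1) := by
    ext y; rw [(h1 y).fderiv]; simp
  rw [h4, (h2.fun_mul h3.hasFDerivAt).fderiv]
  simp
  ring

theorem contDiff_norm_sub_sq_add_rpow (c : EuclideanSpace ℝ (Fin N)) {E : ℝ} (hE : 0 < E) (r : ℝ) :
    ContDiff ℝ 2 (fun y => (‖y - c‖ ^ 2 + E) ^ r) := by
  refine ContDiff.rpow_const_of_ne ?_ fun y => by positivity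
  exact ((contDiff_id.sub contDiff_const).norm_sq ℝ).add contDiff_const

theorem hasFDerivAt_norm_sub_sq_add_rpow (c y : EuclideanSpace ℝ (Fin N)) {E : ℝ} (hE : 0 < E)
    (r : ℝ) :
    HasFDerivAt (fun y => (‖y - c‖ ^ 2 + E) ^ r)
      ((r * (‖y - c‖ ^ 2 + E) ^ (r - 1)) • (2 • innerSL ℝ (y - c))) y := by
  have h1 : HasFDerivAt (fun y => ‖y - c‖ ^ 2 + E) (2 • innerSL ℝ (y - c)) y := by
    simpa using (((hasFDerivAt_id y).sub_const c).norm_sq).add_const E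
  exact h1.rpow_const (Or.inl (by positivity))

/-- For `r = -(N - 2) / 2` these are the Aubin–Talenti bubbles. -/
theorem lap_norm_sub_sq_add_rpow (c x : EuclideanSpace ℝ (Fin N)) {E r : ℝ} (hE : 0 < E)
    (hr : 2 * r = 2 - N) :
    lap (fun y => (‖y - c‖ ^ 2 + E) ^ r) x
      = 2 * r * N * E * (‖x - c‖ ^ 2 + E) ^ (r - 2) := by
  rw [lap_eq_sum_fderiv (contDiff_norm_sub_sq_add_rpow c hE r).contDiffAt]
  set T := ‖x - c‖ ^ 2 + E with hT
  have hTpos : 0 < T := by positivity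
  have key : ∀ i : Fin N, fderiv ℝ (fun y => fderiv ℝ (fun y => (‖y - c‖ ^ 2 + E) ^ r) y
      (EuclideanSpace.single i 1)) x (EuclideanSpace.single i 1)
      = 2 * r * T ^ (r - 1) + 4 * r * (r - 1) * T ^ (r - 2) * (x - c) i ^ 2 := by
    intro i
    have h1 : (fun y => fderiv ℝ (fun y => (‖y - c‖ ^ 2 + E) ^ r) y (EuclideanSpace.single i 1))
        = fun y => (2 * r) * ((‖y - c‖ ^ 2 + E) ^ (r - 1) * (y i - c i)) := by
      ext y
      rw [(hasFDerivAt_norm_sub_sq_add_rpow c y hE r).fderiv]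
      simp [EuclideanSpace.inner_single_right]
      ring
    have h2 : HasFDerivAt (fun y : EuclideanSpace ℝ (Fin N) => y i - c i)
        (EuclideanSpace.proj i : EuclideanSpace ℝ (Fin N) →L[ℝ] ℝ) x :=
      (EuclideanSpace.proj i : EuclideanSpace ℝ (Fin N) →L[ℝ] ℝ).hasFDerivAt.sub_const (c i)
    rw [h1, (((hasFDerivAt_norm_sub_sq_add_rpow c x hE (r - 1)).fun_mul h2).const_mul (2 * r)).fderiv]
    simp [EuclideanSpace.inner_single_right, ← hT]
    rw [show r - 1 - 1 = r - 2 by ring]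
    ring
  have hsum : ∑ i : Fin N, (x - c) i ^ 2 = T - E := by
    rw [hT, EuclideanSpace.norm_sq_eq]; simp
  have hpow : T ^ (r - 1) = T * T ^ (r - 2) := by
    rw [show r - 1 = 1 + (r - 2) by ring, Real.rpow_add hTpos, Real.rpow_one]
  simp only [key, Finset.sum_add_distrib, ← Finset.mul_sum, hsum, hpow]
  simp
  have hN : (N : ℝ) = 2 - 2 * r := by linarith
  rw [hN]
  ring

theorem integral_mul_lap_eq {u ψ : EuclideanSpace ℝ (Fin N) → ℝ} (hu : ContDiff ℝ 2 u)
    (hψ : ContDiff ℝ 2 ψ) (hc : HasCompactSupport ψ) :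
    ∫ x, u x * lap ψ x = ∫ x, lap u x * ψ x := by
  have hd (w : EuclideanSpace ℝ (Fin N) → ℝ) (hw : ContDiff ℝ 2 w) (e) :
      ContDiff ℝ 1 fun y => fderiv ℝ w y e :=
    (hw.fderiv_right (m := 1) (by norm_num)).clm_apply contDiff_const
  have hdd (w : EuclideanSpace ℝ (Fin N) → ℝ) (hw : ContDiff ℝ 2 w) (e) :
      Continuous fun x => fderiv ℝ (fun y => fderiv ℝ w y e) x e :=
    ((hd w hw e).continuous_fderiv (by norm_num)).clm_apply continuous_const
  have cψ' (e) : HasCompactSupport fun y => fderiv ℝ ψ y e := hc.fderiv_apply ℝ e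
  have cψ'' (e) : HasCompactSupport fun x => fderiv ℝ (fun y => fderiv ℝ ψ y e) x e :=
    (cψ' e).fderiv_apply ℝ e
  have int1 (e) : Integrable fun x => u x * fderiv ℝ (fun y => fderiv ℝ ψ y e) x e :=
    (hu.continuous.mul (hdd ψ hψ e)).integrable_of_hasCompactSupport (cψ'' e).mul_left
  have int2 (e) : Integrable fun x => fderiv ℝ u x e * fderiv ℝ ψ x e :=
    ((hd u hu e).continuous.mul (hd ψ hψ e).continuous).integrable_of_hasCompactSupport
      (cψ' e).mul_left
  have int3 (e) : Integrable fun x => fderiv ℝ (fun y => fderiv ℝ u y e) x e * ψ x :=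
    ((hdd u hu e).mul hψ.continuous).integrable_of_hasCompactSupport hc.mul_left
  have int4 (e) : Integrable fun x => fderiv ℝ u x e * ψ x :=
    ((hd u hu e).continuous.mul hψ.continuous).integrable_of_hasCompactSupport hc.mul_left
  have int5 (e) : Integrable fun x => u x * fderiv ℝ ψ x e :=
    (hu.continuous.mul (hd ψ hψ e).continuous).integrable_of_hasCompactSupport (cψ' e).mul_left
  simp only [lap_eq_sum_fderiv hu.contDiffAt, lap_eq_sum_fderiv hψ.contDiffAt, Finset.mul_sum,
    Finset.sum_mul]
  rw [integral_finsetSum _ fun i _ => int1 _, integral_finsetSum _ fun i _ => int3 _]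
  refine Finset.sum_congr rfl fun i _ => ?_
  rw [integral_mul_fderiv_eq_neg_fderiv_mul_of_integrable (int2 _) (int1 _) (int5 _)
      (fun x _ => hu.differentiable (by norm_num) x)
      (fun x _ => (hd ψ hψ _).differentiable (by norm_num) x),
    integral_mul_fderiv_eq_neg_fderiv_mul_of_integrable (int3 _) (int2 _) (int4 _)
      (fun x _ => (hd u hu _).differentiable (by norm_num) x)
      (fun x _ => hψ.differentiable (by norm_num) x), neg_neg]

end Laplacian

section GreenFormula

variable {N : ℕ}

theorem integral_mul_lap_eq_of_eventuallyEq_zero {u ψ : EuclideanSpace ℝ (Fin N) → ℝ}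
    (hu : ContDiffOn ℝ 2 u (univ \ {0})) (hψ : ContDiff ℝ 2 ψ) (hc : HasCompactSupport ψ)
    (h0 : ψ =ᶠ[nhds 0] 0) :
    ∫ x, u x * lap ψ x = ∫ x, lap u x * ψ x := by
  obtain ⟨r, hr, hball⟩ := Metric.eventually_nhds_iff_ball.1 h0
  let χ : ContDiffBump (0 : EuclideanSpace ℝ (Fin N)) := ⟨r / 3, r / 2, by positivity, by linarith⟩
  set w : EuclideanSpace ℝ (Fin N) → ℝ := fun x => (1 - χ x) * u x with hw
  have hwC : ContDiff ℝ 2 w := by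
    rw [contDiff_iff_contDiffAt]
    intro x
    by_cases hx : x = 0
    · have : w =ᶠ[nhds x] fun _ => 0 := by
        rw [hx]
        filter_upwards [χ.eventuallyEq_one] with y hy
        simp [hw, hy]
      exact contDiffAt_const.congr_of_eventuallyEq this
    · exact (contDiffAt_const.sub χ.contDiffAt).mul
        (hu.contDiffAt (isOpen_univ_sdiff_zero.mem_nhds (by simp [hx])))
  have hball' (x) (hx : x ∈ ball 0 r) : ψ x = 0 := hball x hx
  have hwu (x) (hx : r / 2 < ‖x‖) : w =ᶠ[nhds x] u := by
    have : {y : EuclideanSpace ℝ (Fin N) | r / 2 < ‖y‖} ∈ nhds x :=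
      (isOpen_lt continuous_const continuous_norm).mem_nhds hx
    filter_upwards [this] with y hy
    have : χ y = 0 := χ.zero_of_le_dist (by simpa using le_of_lt hy)
    simp [hw, this]
  have key := integral_mul_lap_eq hwC hψ hc
  rw [integral_congr_ae (.of_forall fun x => ?_), key, integral_congr_ae (.of_forall fun x => ?_)]
  · rcases lt_or_ge (r / 2) ‖x‖ with hx | hx
    · simp [lap_congr (hwu x hx)]
    · simp [hball' x (by simp; linarith)]
  · rcases lt_or_ge (r / 2) ‖x‖ with hx | hx
    · simp [(hwu x hx).eq_of_nhds]
    · have : ψ =ᶠ[nhds x] fun _ => 0 := by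
        filter_upwards [isOpen_ball.mem_nhds (show x ∈ ball 0 r by simp; linarith)] with y hy
        exact hball' y hy
      have h1 : lap ψ x = 0 := by
        rw [lap_congr this, lap_eq_sum_fderiv contDiffAt_const]
        simp
      simp [h1]

end GreenFormula

/-- A `C²` regularisation of the positive part of `s - k`. -/
theorem exists_convex_truncation (k : ℝ) :
    ∃ H : ℝ → ℝ, ContDiff ℝ 2 H ∧ (∀ s ≤ k, H s = 0) ∧
      (∀ s, 0 ≤ deriv H s) ∧ (∀ s, deriv H s ≤ 1) ∧ (∀ s, 0 ≤ deriv (deriv H) s) ∧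
      Monotone H ∧ ∀ s > k, 0 < H s := by
  have hcont : Continuous fun t => Real.smoothTransition (t - k) :=
    Real.smoothTransition.continuous.comp (continuous_id.sub continuous_const)
  have hH : ∀ s, HasDerivAt (fun s => ∫ t in k..s, Real.smoothTransition (t - k))
      (Real.smoothTransition (s - k)) s := fun s =>
    intervalIntegral.integral_hasDerivAt_right (hcont.intervalIntegrable _ _)
      (hcont.stronglyMeasurableAtFilter _ _) hcont.continuousAt
  have hd : deriv (fun s => ∫ t in k..s, Real.smoothTransition (t - k))
      = fun s => Real.smoothTransition (s - k) := funext fun s => (hH s).deriv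
  have hnonneg (s : ℝ) : 0 ≤ Real.smoothTransition (s - k) := Real.smoothTransition.nonneg _
  have hmono : Monotone fun s => Real.smoothTransition (s - k) := fun s t hst =>
    Real.smoothTransition.monotone (by linarith)
  refine ⟨fun s => ∫ t in k..s, Real.smoothTransition (t - k), ?_, fun s hs => ?_, fun s => ?_, fun s => ?_, fun s => ?_, ?_, fun s hs => ?_⟩
  · refine (contDiff_succ_iff_deriv (n := 1)).2 ⟨fun s => (hH s).differentiableAt, by simp, ?_⟩
    rw [hd]
    exact Real.smoothTransition.contDiff.comp (contDiff_id.sub contDiff_const)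
  · dsimp only
    rw [intervalIntegral.integral_symm, neg_eq_zero]
    refine (intervalIntegral.integral_congr fun t ht => ?_).trans intervalIntegral.integral_zero
    rw [uIcc_of_le hs] at ht
    exact Real.smoothTransition.zero_of_nonpos (by linarith [ht.2])
  · rw [hd]; exact hnonneg s
  · rw [hd]; exact Real.smoothTransition.le_one _
  · rw [hd]; exact hmono.deriv_nonneg
  · exact monotone_of_deriv_nonneg (fun s => (hH s).differentiableAt) (by rw [hd]; exact hnonneg)
  · exact intervalIntegral.intervalIntegral_pos_of_pos_on (hcont.intervalIntegrable _ _)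
      (fun t ht => Real.smoothTransition.pos_of_pos (by linarith [ht.1])) hs

section Superharmonic

variable {N : ℕ}

/-- Test functions for the lower bound of a superharmonic function at `x₀`: they vanish near the
origin, are bounded below on the annulus, and their `-lap` is bounded above by a bubble
concentrating at `x₀` as `c → ∞`. -/
theorem exists_test_function (hN : 3 ≤ N) :
    ∃ κ > 0, ∃ L : ℝ, ∀ x₀ : EuclideanSpace ℝ (Fin N), ‖x₀‖ < 1 → ∀ c : ℝ, 1 ≤ c →
      ∃ ψ : EuclideanSpace ℝ (Fin N) → ℝ, ContDiff ℝ 2 ψ ∧ HasCompactSupport ψ ∧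
        ψ =ᶠ[nhds 0] 0 ∧ (∀ x, 0 ≤ ψ x) ∧ (∀ x, 1 / 2 < ‖x‖ → ‖x‖ < 1 → κ ≤ ψ x) ∧
        (∀ x ∉ closedBall x₀ L, lap ψ x = 0) ∧
        ∀ x, -lap ψ x ≤ c ^ N * ((N - 2) * N * (1 + ‖c • (x₀ - x)‖ ^ 2) ^ (-(N + 2 : ℝ) / 2)) := by
  have hN' : (3 : ℝ) ≤ N := by exact_mod_cast hN
  obtain ⟨r, hr⟩ : ∃ r : ℝ, 2 * r = 2 - N := ⟨(2 - N) / 2, by ring⟩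
  have hr0 : r < 0 := by linarith
  set k : ℝ := 5 ^ r / 3 with hk
  have hkpos : 0 < k := by positivity
  set s : ℝ := k * 4 ^ r with hs
  have hspos : 0 < s := by positivity
  set θ : ℝ := s ^ (-r⁻¹) with hθ
  have hθpos : 0 < θ := by positivity
  have hθr : s * θ ^ r = 1 := by
    rw [hθ, ← Real.rpow_mul hspos.le, neg_mul, inv_mul_cancel₀ hr0.ne, Real.rpow_neg_one,
      mul_inv_cancel₀ hspos.ne']
  obtain ⟨H, hHC, hH0, hH'nn, hH'le, hH''nn, hHmono, hHpos⟩ := exists_convex_truncation k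
  set L : ℝ := √(k ^ r⁻¹) with hL
  have hL2 : L ^ 2 = k ^ r⁻¹ := Real.sq_sqrt (by positivity)
  have hLr : (L ^ 2) ^ r = k := by
    rw [hL2, ← Real.rpow_mul hkpos.le, inv_mul_cancel₀ hr0.ne, Real.rpow_one]
  refine ⟨H (2 * k), hHpos _ (by linarith), L, fun x₀ hx₀ c hc => ?_⟩
  have hc0 : 0 < c := by linarith
  set E : ℝ := (c ^ 2)⁻¹ with hE
  have hEpos : 0 < E := by positivity
  have hE1 : E ≤ 1 := inv_le_one_of_one_le₀ (one_le_pow₀ hc)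
  set Ψ : EuclideanSpace ℝ (Fin N) → ℝ :=
    fun y => (‖y - x₀‖ ^ 2 + E) ^ r - s * (‖y - 0‖ ^ 2 + E * θ) ^ r with hΨ
  have hC1 := contDiff_norm_sub_sq_add_rpow x₀ hEpos r
  have hC2 := contDiff_norm_sub_sq_add_rpow (0 : EuclideanSpace ℝ (Fin N)) (mul_pos hEpos hθpos) r
  have hΨC : ContDiff ℝ 2 Ψ := hC1.sub (contDiff_const.mul hC2)
  have hfar (y) (hy : y ∉ closedBall x₀ L) : Ψ y < k := by
    have h1 : L < ‖y - x₀‖ := by simpa [dist_eq_norm] using hy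
    have h2 : (‖y - x₀‖ ^ 2 + E) ^ r ≤ (L ^ 2) ^ r := by
      refine Real.rpow_le_rpow_of_nonpos (by rw [hL2]; positivity) ?_ hr0.le
      have : L ^ 2 ≤ ‖y - x₀‖ ^ 2 := by gcongr
      linarith
    have h3 : 0 < s * (‖y - 0‖ ^ 2 + E * θ) ^ r := by positivity
    simp only [hΨ]
    linarith
  have hzero : Ψ 0 < k := by
    have h1 : (‖(0 : EuclideanSpace ℝ (Fin N)) - x₀‖ ^ 2 + E) ^ r ≤ E ^ r :=
      Real.rpow_le_rpow_of_nonpos hEpos (by simp) hr0.le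
    have h2 : s * (‖(0 : EuclideanSpace ℝ (Fin N)) - 0‖ ^ 2 + E * θ) ^ r = E ^ r := by
      rw [sub_self, norm_zero, zero_pow two_ne_zero, zero_add, Real.mul_rpow hEpos.le hθpos.le,
        mul_left_comm, hθr, mul_one]
    simp only [hΨ]
    linarith
  have hannulus (y : EuclideanSpace ℝ (Fin N)) (hy : 1 / 2 < ‖y‖) (hy' : ‖y‖ < 1) :
      2 * k ≤ Ψ y := by
    have h1 : 5 ^ r ≤ (‖y - x₀‖ ^ 2 + E) ^ r := by
      refine Real.rpow_le_rpow_of_nonpos (by positivity) ?_ hr0.le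
      have h : ‖y - x₀‖ ≤ 2 := (norm_sub_le _ _).trans (by linarith)
      nlinarith [norm_nonneg (y - x₀)]
    have h2 : (‖y - 0‖ ^ 2 + E * θ) ^ r ≤ (4⁻¹) ^ r := by
      refine Real.rpow_le_rpow_of_nonpos (by positivity) ?_ hr0.le
      rw [sub_zero]
      nlinarith [mul_pos hEpos hθpos]
    have h3 : s * (4⁻¹) ^ r = k := by
      rw [hs, mul_assoc, ← Real.mul_rpow (by norm_num) (by norm_num)]
      norm_num
    have h4 := mul_le_mul_of_nonneg_left h2 hspos.le
    have h5 : 3 * k = 5 ^ r := by rw [hk]; ring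
    simp only [hΨ]
    linarith
  have hψC : ContDiff ℝ 2 fun y => H (Ψ y) := hHC.comp hΨC
  have hlow {x} (hx : Ψ x < k) : (fun y => H (Ψ y)) =ᶠ[nhds x] fun _ => 0 := by
    filter_upwards [hΨC.continuous.continuousAt.eventually_lt_const hx] with y hy
    exact hH0 _ hy.le
  have hHnn (t : ℝ) : 0 ≤ H t := by
    rcases le_or_gt t k with h | h
    · rw [hH0 t h]
    · exact (hHpos t h).le
  refine ⟨fun y => H (Ψ y), hψC, .intro (isCompact_closedBall x₀ L) fun y hy => hH0 _ (hfar y hy).le,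
    hlow hzero, fun x => hHnn _, fun x h h' => hHmono (hannulus x h h'), fun x hx => ?_, fun x => ?_⟩
  · rw [lap_congr (hlow (hfar x hx)), lap_eq_sum_fderiv contDiffAt_const]
    simp
  · rw [lap_comp hHC hΨC, lap_sub_const_mul hC1.contDiffAt hC2.contDiffAt,
      lap_norm_sub_sq_add_rpow x₀ x hEpos hr,
      lap_norm_sub_sq_add_rpow 0 x (mul_pos hEpos hθpos) hr]
    have hbubble : c ^ N * ((N - 2) * N * (1 + ‖c • (x₀ - x)‖ ^ 2) ^ (-(N + 2 : ℝ) / 2))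
        = (N - 2) * N * E * (‖x - x₀‖ ^ 2 + E) ^ (r - 2) := by
      have h1 : 1 + ‖c • (x₀ - x)‖ ^ 2 = c ^ 2 * (‖x - x₀‖ ^ 2 + E) := by
        rw [norm_smul, norm_sub_rev, Real.norm_of_nonneg hc0.le, hE]
        field_simp
        ring
      have h2 : -(N + 2 : ℝ) / 2 = r - 2 := by linarith
      have h3 : (c ^ 2) ^ (r - 2) = (c ^ N)⁻¹ * E := by
        rw [← Real.rpow_natCast c 2, ← Real.rpow_mul hc0.le,
          show ((2 : ℕ) : ℝ) * (r - 2) = -(N : ℝ) + -((2 : ℕ) : ℝ) by push_cast; linarith,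
          Real.rpow_add hc0, Real.rpow_neg hc0.le, Real.rpow_neg hc0.le, Real.rpow_natCast,
          Real.rpow_natCast]
      rw [h1, h2, Real.mul_rpow (by positivity) (by positivity), h3]
      field_simp
    rw [hbubble, hr]
    set A : ℝ := (‖x - x₀‖ ^ 2 + E) ^ (r - 2) with hA
    set B : ℝ := (‖x - 0‖ ^ 2 + E * θ) ^ (r - 2) with hB
    have hApos : 0 ≤ A := by positivity
    have hBpos : 0 ≤ B := by positivity
    have h1 : 0 ≤ deriv (deriv H) (Ψ x)
        * ∑ i : Fin N, (fderiv ℝ Ψ x (EuclideanSpace.single i 1)) ^ 2 :=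
      mul_nonneg (hH''nn _) (Finset.sum_nonneg fun i _ => sq_nonneg _)
    have hN2 : (0 : ℝ) ≤ N - 2 := by linarith
    have h2 : 0 ≤ deriv H (Ψ x) * (s * ((N - 2) * N * (E * θ) * B)) :=
      mul_nonneg (hH'nn _) (by positivity)
    have h3 : deriv H (Ψ x) * ((N - 2) * N * E * A) ≤ 1 * ((N - 2) * N * E * A) :=
      mul_le_mul_of_nonneg_right (hH'le _) (by positivity)
    linarith

theorem tendsto_norm_pow_mul_bubble (C : ℝ) (hC : 0 ≤ C) :
    Tendsto (fun z : EuclideanSpace ℝ (Fin N) =>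
      ‖z‖ ^ N * (C * (1 + ‖z‖ ^ 2) ^ (-(N + 2 : ℝ) / 2))) (Bornology.cobounded _) (nhds 0) := by
  have hbound : Tendsto (fun z : EuclideanSpace ℝ (Fin N) => C * (‖z‖ ^ 2)⁻¹)
      (Bornology.cobounded _) (nhds 0) := by
    have h : Tendsto (fun z : EuclideanSpace ℝ (Fin N) => (‖z‖ ^ 2)⁻¹)
        (Bornology.cobounded _) (nhds 0) :=
      tendsto_inv_atTop_zero.comp
        ((tendsto_pow_atTop two_ne_zero).comp tendsto_norm_cobounded_atTop)
    simpa using h.const_mul C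
  refine squeeze_zero' (.of_forall fun z => by positivity) ?_ hbound
  filter_upwards [tendsto_norm_cobounded_atTop.eventually_gt_atTop 0] with z hz
  have h1 : (1 + ‖z‖ ^ 2) ^ (-(N + 2 : ℝ) / 2) ≤ (‖z‖ ^ N)⁻¹ * (‖z‖ ^ 2)⁻¹ := by
    calc (1 + ‖z‖ ^ 2) ^ (-(N + 2 : ℝ) / 2) ≤ (‖z‖ ^ 2) ^ (-(N + 2 : ℝ) / 2) :=
          Real.rpow_le_rpow_of_nonpos (by positivity) (by linarith)
            (by rw [neg_div]; exact neg_nonpos.2 (by positivity))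
      _ = (‖z‖ ^ N)⁻¹ * (‖z‖ ^ 2)⁻¹ := by
        rw [← Real.rpow_natCast ‖z‖ 2, ← Real.rpow_mul hz.le,
          show ((2 : ℕ) : ℝ) * (-(N + 2 : ℝ) / 2) = -(N : ℝ) + -((2 : ℕ) : ℝ) by
            push_cast; ring,
          Real.rpow_add hz, Real.rpow_neg hz.le, Real.rpow_neg hz.le, Real.rpow_natCast,
          Real.rpow_natCast]
  calc ‖z‖ ^ N * (C * (1 + ‖z‖ ^ 2) ^ (-(N + 2 : ℝ) / 2))
      ≤ ‖z‖ ^ N * (C * ((‖z‖ ^ N)⁻¹ * (‖z‖ ^ 2)⁻¹)) := by gcongr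
    _ = C * (‖z‖ ^ 2)⁻¹ := by field_simp

/-- A nonnegative superharmonic function dominates the mass of its Laplacian on an annulus. -/
theorem exists_setIntegral_neg_lap_le (hN : 3 ≤ N) :
    ∃ K > 0, ∀ u : EuclideanSpace ℝ (Fin N) → ℝ, Continuous u → ContDiffOn ℝ 2 u (univ \ {0}) →
      (∀ x, 0 ≤ u x) → (∀ x ≠ 0, 0 ≤ -lap u x) →
      ∀ x₀ : EuclideanSpace ℝ (Fin N), ‖x₀‖ < 1 →
        ∫ x in {x : EuclideanSpace ℝ (Fin N) | 1 / 2 < ‖x‖ ∧ ‖x‖ < 1}, -lap u x ≤ K * u x₀ := by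
  obtain ⟨κ, hκ, L, hψ⟩ := exists_test_function hN
  have hN' : (3 : ℝ) ≤ N := by exact_mod_cast hN
  have hN2 : (0 : ℝ) < (N - 2) * N := by nlinarith
  set φ : EuclideanSpace ℝ (Fin N) → ℝ :=
    fun z => (N - 2) * N * (1 + ‖z‖ ^ 2) ^ (-(N + 2 : ℝ) / 2) with hφ
  have hφpos (z) : 0 < φ z := by simp only [hφ]; positivity
  have hφint : Integrable φ := (integrable_rpow_neg_one_add_norm_sq (by simp)).const_mul _
  have hφc : Continuous φ := by
    refine continuous_const.mul (Continuous.rpow_const (by fun_prop) fun x => Or.inl ?_)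
    positivity
  set S : ℝ := ∫ z, φ z with hS
  have hSpos : 0 < S := by
    rw [hS, integral_pos_iff_support_of_nonneg (fun z => (hφpos z).le) hφint]
    rw [show Function.support φ = univ from eq_univ_of_forall fun z => (hφpos z).ne']
    simpa using NeZero.ne (volume : Measure (EuclideanSpace ℝ (Fin N)))
  refine ⟨S / κ, by positivity, fun u huc hu hu0 hlap x₀ hx₀ => ?_⟩
  rw [div_mul_eq_mul_div, le_div_iff₀ hκ]
  set g : EuclideanSpace ℝ (Fin N) → ℝ := (closedBall x₀ (max L 1)).indicator u with hg
  have hgint : Integrable g :=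
    (huc.continuousOn.integrableOn_compact (isCompact_closedBall _ _)).integrable_indicator
      isClosed_closedBall.measurableSet
  have hgx₀ : g =ᶠ[nhds x₀] u := by
    filter_upwards [closedBall_mem_nhds x₀ (lt_max_of_lt_right one_pos)] with y hy
    exact indicator_of_mem hy u
  have hlim := tendsto_integral_comp_smul_smul_of_integrable' (μ := volume) (φ := fun z => φ z / S)
    (x₀ := x₀) (fun z => div_nonneg (hφpos z).le hSpos.le)
    (by rw [integral_div, div_self hSpos.ne'])
    (by
      rw [finrank_euclideanSpace_fin]
      simpa [hφ, mul_div_assoc] using (tendsto_norm_pow_mul_bubble _ hN2.le).div_const S) hgint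
    (huc.continuousAt.congr hgx₀.symm)
  rw [hgx₀.eq_of_nhds, finrank_euclideanSpace_fin] at hlim
  have hlapc : ContinuousOn (lap u) (univ \ {0}) :=
    continuousOn_lap isOpen_univ_sdiff_zero hu
  refine ge_of_tendsto (hlim.const_mul S) ?_
  filter_upwards [eventually_ge_atTop 1] with c hc
  obtain ⟨ψ, hψC, hψc, hψ0, hψnn, hψκ, hψfar, hψlap⟩ := hψ x₀ hx₀ c hc
  have hae : ∀ᵐ x : EuclideanSpace ℝ (Fin N), x ≠ 0 := by
    have : Nontrivial (EuclideanSpace ℝ (Fin N)) := by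
      have : Nonempty (Fin N) := ⟨⟨0, by omega⟩⟩
      infer_instance
    exact Measure.ae_ne volume 0
  have hlapψ : Continuous fun x => -lap u x * ψ x := by
    rw [continuous_iff_continuousAt]
    intro x
    by_cases hx : x = 0
    · rw [hx]
      refine (continuousAt_const (y := (0 : ℝ))).congr ?_
      filter_upwards [hψ0] with y hy
      simp [hy]
    · exact (hlapc.continuousAt (isOpen_univ_sdiff_zero.mem_nhds (by simp [hx]))).neg.mul
        hψC.continuous.continuousAt
  have hint : Integrable fun x => -lap u x * ψ x :=
    hlapψ.integrable_of_hasCompactSupport hψc.mul_left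
  set A := {x : EuclideanSpace ℝ (Fin N) | 1 / 2 < ‖x‖ ∧ ‖x‖ < 1} with hA
  have hAm : MeasurableSet A := (isOpen_annulus (1 / 2) 1).measurableSet
  have hintA : IntegrableOn (fun x => -lap u x) A := by
    refine ((hlapc.neg.mono fun x hx => ?_).integrableOn_compact (isCompact_annulus (1 / 2) 1)).mono_set
      fun x hx => ⟨hx.1.le, hx.2.le⟩
    have : 0 < ‖x‖ := by linarith [hx.1]
    simpa using this
  have h1 : (∫ x in A, -lap u x) * κ ≤ ∫ x, -lap u x * ψ x := by
    rw [← integral_mul_const]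
    refine (setIntegral_mono_on (hintA.mul_const κ) hint.integrableOn hAm fun x hx => ?_).trans
      (setIntegral_le_integral hint ?_)
    · have : 0 < ‖x‖ := by linarith [hx.1]
      exact mul_le_mul_of_nonneg_left (hψκ x hx.1 hx.2) (hlap x (norm_pos_iff.1 this))
    · filter_upwards [hae] with x hx
      exact mul_nonneg (hlap x hx) (hψnn x)
  have h2 : ∫ x, -lap u x * ψ x = ∫ x, u x * -lap ψ x := by
    simp only [neg_mul, mul_neg, integral_neg]
    rw [integral_mul_lap_eq_of_eventuallyEq_zero hu hψC hψc hψ0]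
  rw [h2] at h1
  refine h1.trans ?_
  rw [← integral_const_mul]
  have hright : (fun x => S * ((c ^ N * (φ (c • (x₀ - x)) / S)) • g x))
      = (closedBall x₀ (max L 1)).indicator fun x => c ^ N * φ (c • (x₀ - x)) * u x := by
    ext x
    by_cases hx : x ∈ closedBall x₀ (max L 1)
    · simp only [hg, indicator_of_mem hx, smul_eq_mul]
      field_simp
    · simp [hg, hx]
  have hleft : Integrable fun x => u x * -lap ψ x :=
    (huc.mul (continuous_lap hψC).neg).integrable_of_hasCompactSupport <|
      .intro (isCompact_closedBall x₀ L) fun x hx => by simp [hψfar x hx]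
  rw [hright]
  have hrightc : Continuous fun x => c ^ N * φ (c • (x₀ - x)) * u x := by fun_prop
  refine integral_mono hleft ((hrightc.continuousOn.integrableOn_compact
    (isCompact_closedBall _ _)).integrable_indicator isClosed_closedBall.measurableSet) fun x => ?_
  by_cases hx : x ∈ closedBall x₀ (max L 1)
  · simp only [indicator_of_mem hx]
    rw [mul_comm (u x)]
    exact mul_le_mul_of_nonneg_right (hψlap x) (hu0 x)
  · have : x ∉ closedBall x₀ L := fun h => hx (closedBall_subset_closedBall (le_max_left _ _) h)
    simp [hx, hψfar x this]

end Superharmonic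

section Estimates

variable {N : ℕ}

theorem exists_mul_rpow_le_setIntegral (hN : 0 < N) (a : ℝ) {p : ℝ} (hp : 0 < p) :
    ∃ κ > 0, ∀ v : EuclideanSpace ℝ (Fin N) → ℝ, Continuous v →
      ∀ M : ℝ, 0 ≤ M → (∀ x, ‖x‖ < 1 → M ≤ v x) →
        κ * M ^ p ≤
          ∫ x in {x : EuclideanSpace ℝ (Fin N) | 1 / 2 < ‖x‖ ∧ ‖x‖ < 1}, ‖x‖ ^ a * v x ^ p := by
  set A := {x : EuclideanSpace ℝ (Fin N) | 1 / 2 < ‖x‖ ∧ ‖x‖ < 1} with hA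
  have hAo : IsOpen A := isOpen_annulus (1 / 2) 1
  have hAne : A.Nonempty := by
    refine ⟨EuclideanSpace.single ⟨0, hN⟩ (3 / 4), ?_, ?_⟩ <;> simp <;> norm_num
  have hAfin : volume A < ⊤ := measure_ball_lt_top.trans_le' <| measure_mono fun x hx =>
    (by simpa using hx.2 : x ∈ ball (0 : EuclideanSpace ℝ (Fin N)) 1)
  have hApos : 0 < volume.real A := ENNReal.toReal_pos (hAo.measure_pos volume hAne).ne' hAfin.ne
  refine ⟨volume.real A * (1 / 2) ^ |a|, by positivity, fun v hv M hM hMv => ?_⟩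
  have hint : IntegrableOn (fun x => ‖x‖ ^ a * v x ^ p) A := by
    refine ContinuousOn.integrableOn_compact (isCompact_annulus (1 / 2) 1) ?_ |>.mono_set
      fun x hx => ⟨hx.1.le, hx.2.le⟩
    refine (continuous_norm.continuousOn.rpow_const fun x hx => Or.inl ?_).mul
      (hv.continuousOn.rpow_const fun x _ => Or.inr hp.le)
    have := hx.1
    positivity
  have hconst : ∫ _ in A, (1 / 2 : ℝ) ^ |a| * M ^ p = volume.real A * (1 / 2) ^ |a| * M ^ p := by
    rw [setIntegral_const, smul_eq_mul, mul_assoc]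
  rw [← hconst]
  refine setIntegral_mono_on (integrableOn_const hAfin.ne) hint hAo.measurableSet fun x hx => ?_
  have hx0 : 0 < ‖x‖ := by linarith [hx.1]
  have h1 : (1 / 2 : ℝ) ^ |a| ≤ ‖x‖ ^ a :=
    (Real.rpow_le_rpow (by norm_num) hx.1.le (abs_nonneg a)).trans
      (Real.rpow_le_rpow_of_exponent_ge hx0 hx.2.le (le_abs_self a))
  have h2 : M ^ p ≤ v x ^ p := Real.rpow_le_rpow hM (hMv x hx.2) hp.le
  gcongr

open scoped Pointwise in
theorem setIntegral_annulus_eq (f : EuclideanSpace ℝ (Fin N) → ℝ) {R : ℝ} (hR : 0 < R) :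
    ∫ x in {x : EuclideanSpace ℝ (Fin N) | R / 2 < ‖x‖ ∧ ‖x‖ < R}, f x
      = R ^ N * ∫ x in {x : EuclideanSpace ℝ (Fin N) | 1 / 2 < ‖x‖ ∧ ‖x‖ < 1}, f (R • x) := by
  have hset : R • {x : EuclideanSpace ℝ (Fin N) | 1 / 2 < ‖x‖ ∧ ‖x‖ < 1}
      = {x : EuclideanSpace ℝ (Fin N) | R / 2 < ‖x‖ ∧ ‖x‖ < R} := by
    ext x
    rw [mem_smul_set_iff_inv_smul_mem₀ hR.ne']
    simp only [mem_ofPred_eq, norm_smul, norm_inv, Real.norm_of_nonneg hR.le]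
    rw [lt_inv_mul_iff₀ hR, inv_mul_lt_iff₀ hR, mul_one, mul_one_div]
  rw [Measure.setIntegral_comp_smul_of_pos _ _ _ hR, hset, finrank_euclideanSpace_fin, smul_eq_mul,
    mul_inv_cancel_left₀ (by positivity)]

theorem IsHHSol.swap {a b p q : ℝ} {Ω : Set (EuclideanSpace ℝ (Fin N))}
    {u v : EuclideanSpace ℝ (Fin N) → ℝ} (h : IsHHSol a b p q Ω u v) : IsHHSol b a q p Ω v u :=
  let ⟨h1, h2, h3, h4, h5, h6, h7, h8⟩ := h
  ⟨h2, h1, h4, h3, h6, h5, h8, h7⟩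

/-- The estimate of the source term of the first equation at scale `R` by the values of `u`. -/
theorem IsHHSol.setIntegral_le {a b p q K : ℝ} {u v : EuclideanSpace ℝ (Fin N) → ℝ}
    (hK : ∀ u : EuclideanSpace ℝ (Fin N) → ℝ, Continuous u → ContDiffOn ℝ 2 u (univ \ {0}) →
      (∀ x, 0 ≤ u x) → (∀ x ≠ 0, 0 ≤ -lap u x) →
      ∀ x₀ : EuclideanSpace ℝ (Fin N), ‖x₀‖ < 1 →
        ∫ x in {x : EuclideanSpace ℝ (Fin N) | 1 / 2 < ‖x‖ ∧ ‖x‖ < 1}, -lap u x ≤ K * u x₀)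
    (h : IsHHSol a b p q univ u v) {R : ℝ} (hR : 0 < R) {x₀ : EuclideanSpace ℝ (Fin N)}
    (hx₀ : ‖x₀‖ < 1) :
    R ^ (2 + a) * ∫ x in {x : EuclideanSpace ℝ (Fin N) | 1 / 2 < ‖x‖ ∧ ‖x‖ < 1},
      ‖x‖ ^ a * v (R • x) ^ p ≤ K * u (R • x₀) := by
  obtain ⟨huc, -, hu, -, hupos, hvpos, heq, -⟩ := h
  have hlap (x : EuclideanSpace ℝ (Fin N)) (hx : x ≠ 0) :
      -lap (fun y => u (R • y)) x = R ^ (2 + a) * (‖x‖ ^ a * v (R • x) ^ p) := by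
    have hRx : R • x ∈ (univ \ {0} : Set (EuclideanSpace ℝ (Fin N))) := by simp [hR.ne', hx]
    rw [lap_comp_smul (hu.contDiffAt (isOpen_univ_sdiff_zero.mem_nhds hRx)), ← mul_neg, heq _ hRx,
      norm_smul,
      Real.norm_of_nonneg hR.le, Real.mul_rpow hR.le (norm_nonneg x), Real.rpow_add hR,
      Real.rpow_two]
    ring
  have huR : ContDiffOn ℝ 2 (fun y => u (R • y)) (univ \ {0}) :=
    hu.comp (by fun_prop) fun x hx => by simpa [hR.ne'] using hx
  have key := hK (fun y => u (R • y)) ((continuousOn_univ.1 huc).comp (continuous_const_smul R))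
    huR (fun x => (hupos _ trivial).le) (fun x hx => by
      have := hvpos (R • x) trivial
      rw [hlap x hx]
      positivity) x₀ hx₀
  rw [← integral_const_mul]
  refine le_of_eq_of_le ?_ key
  refine setIntegral_congr_fun (isOpen_annulus (1 / 2) 1).measurableSet fun x hx => (hlap x ?_).symm
  have hx1 : 1 / 2 < ‖x‖ := hx.1
  exact norm_pos_iff.1 (by linarith)

theorem le_mul_rpow_of_le_of_le {p q a b κ κ' K R F G : ℝ} (hp : 0 < p) (hpq : 1 < p * q)
    (hκ : 0 < κ) (hκ' : 0 < κ') (hK : 0 < K) (hR : 0 < R) (hF : 0 ≤ F)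
    (hFG : κ * (R ^ (2 + b) * G / K) ^ p ≤ F) (hGF : κ' * (R ^ (2 + a) * F / K) ^ q ≤ G) :
    F ≤ (K ^ (p * q + p) / (κ * κ' ^ p)) ^ (p * q - 1)⁻¹
      * R ^ (-((2 + b) * p + (2 + a) * (p * q)) / (p * q - 1)) := by
  have hd : 0 < p * q - 1 := by linarith
  rcases hF.eq_or_lt with rfl | hF
  · positivity
  have h1 : κ * (R ^ (2 + b) * (κ' * (R ^ (2 + a) * F / K) ^ q) / K) ^ p ≤ F := by
    refine le_trans ?_ hFG
    gcongr
  have h2 : κ * (R ^ (2 + b) * (κ' * (R ^ (2 + a) * F / K) ^ q) / K) ^ p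
      = (κ * κ' ^ p / K ^ (p * q + p)) * R ^ ((2 + b) * p + (2 + a) * (p * q))
        * (F ^ (p * q - 1) * F) := by
    have hFF : F ^ (p * q - 1) * F = F ^ (p * q) := by
      rw [← Real.rpow_add_one hF.ne', sub_add_cancel]
    rw [hFF, Real.div_rpow (by positivity) hK.le, Real.mul_rpow (by positivity) (by positivity),
      Real.mul_rpow hκ'.le (by positivity),
      ← Real.rpow_mul (show 0 ≤ R ^ (2 + a) * F / K by positivity) q p, mul_comm q p,
      Real.div_rpow (by positivity) hK.le, Real.mul_rpow (by positivity) hF.le,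
      ← Real.rpow_mul hR.le, ← Real.rpow_mul hR.le, Real.rpow_add hR, Real.rpow_add hK]
    field_simp
  rw [h2, ← mul_assoc] at h1
  have h3 : (κ * κ' ^ p / K ^ (p * q + p)) * R ^ ((2 + b) * p + (2 + a) * (p * q))
      * F ^ (p * q - 1) ≤ 1 := by
    by_contra! hlt
    nlinarith
  have h4 : F ^ (p * q - 1)
      ≤ K ^ (p * q + p) / (κ * κ' ^ p) * R ^ (-((2 + b) * p + (2 + a) * (p * q))) := by
    rw [Real.rpow_neg hR.le]
    have hRpos : 0 < R ^ ((2 + b) * p + (2 + a) * (p * q)) := by positivity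
    rw [← div_eq_mul_inv, div_div, le_div_iff₀ (by positivity)]
    have hKpos : 0 < K ^ (p * q + p) := by positivity
    calc F ^ (p * q - 1) * (κ * κ' ^ p * R ^ ((2 + b) * p + (2 + a) * (p * q)))
        = K ^ (p * q + p) * ((κ * κ' ^ p / K ^ (p * q + p))
          * R ^ ((2 + b) * p + (2 + a) * (p * q)) * F ^ (p * q - 1)) := by field_simp
      _ ≤ K ^ (p * q + p) * 1 := by gcongr
      _ = K ^ (p * q + p) := mul_one _
  have h5 := Real.rpow_le_rpow (by positivity) h4 (inv_nonneg.2 hd.le)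
  rwa [← Real.rpow_mul hF.le, mul_inv_cancel₀ hd.ne', Real.rpow_one,
    Real.mul_rpow (by positivity) (by positivity), ← Real.rpow_mul hR.le, ← div_eq_mul_inv] at h5

theorem exists_setIntegral_le_mul_rpow (hN : 3 ≤ N) (a b : ℝ) {p q : ℝ} (hp : 0 < p) (hq : 0 < q)
    (hpq : 1 < p * q) :
    ∃ C > 0, ∀ u v : EuclideanSpace ℝ (Fin N) → ℝ, IsHHSol a b p q univ u v → ∀ R > (0 : ℝ),
      (∫ x in {x : EuclideanSpace ℝ (Fin N) | R / 2 < ‖x‖ ∧ ‖x‖ < R}, ‖x‖ ^ a * v x ^ p)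
        ≤ C * R ^ ((N : ℝ) - 2 - 2 * (p + 1) / (p * q - 1) - (a + b * p) / (p * q - 1)) := by
  obtain ⟨K, hK, hKu⟩ := exists_setIntegral_neg_lap_le hN
  obtain ⟨κ, hκ, hκv⟩ := exists_mul_rpow_le_setIntegral (show 0 < N by omega) a hp
  obtain ⟨κ', hκ', hκu⟩ := exists_mul_rpow_le_setIntegral (show 0 < N by omega) b hq
  refine ⟨(K ^ (p * q + p) / (κ * κ' ^ p)) ^ (p * q - 1)⁻¹, by positivity, fun u v h R hR => ?_⟩
  have hd : p * q - 1 ≠ 0 := by linarith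
  set A := {x : EuclideanSpace ℝ (Fin N) | 1 / 2 < ‖x‖ ∧ ‖x‖ < 1} with hA
  set F := ∫ x in A, ‖x‖ ^ a * v (R • x) ^ p with hFdef
  set G := ∫ x in A, ‖x‖ ^ b * u (R • x) ^ q with hGdef
  have hu0 (x) : 0 < u x := h.2.2.2.2.1 x trivial
  have hv0 (x) : 0 < v x := h.2.2.2.2.2.1 x trivial
  have huc : Continuous fun x => u (R • x) :=
    (continuousOn_univ.1 h.1).comp (continuous_const_smul R)
  have hvc : Continuous fun x => v (R • x) :=
    (continuousOn_univ.1 h.2.1).comp (continuous_const_smul R)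
  have hF : 0 ≤ F := integral_nonneg fun x => by have := hv0 (R • x); positivity
  have hG : 0 ≤ G := integral_nonneg fun x => by have := hu0 (R • x); positivity
  have hFG : κ * (R ^ (2 + b) * G / K) ^ p ≤ F :=
    hκv _ hvc _ (by positivity) fun x hx =>
      (div_le_iff₀' hK).2 (h.swap.setIntegral_le hKu hR hx)
  have hGF : κ' * (R ^ (2 + a) * F / K) ^ q ≤ G :=
    hκu _ huc _ (by positivity) fun x hx => (div_le_iff₀' hK).2 (h.setIntegral_le hKu hR hx)
  have hscale : ∫ x in A, ‖R • x‖ ^ a * v (R • x) ^ p = R ^ a * F := by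
    rw [hFdef, ← integral_const_mul]
    refine integral_congr_ae (.of_forall fun x => ?_)
    simp only [norm_smul, Real.norm_of_nonneg hR.le, Real.mul_rpow hR.le (norm_nonneg x), mul_assoc]
  have hexp : (N : ℝ) - 2 - 2 * (p + 1) / (p * q - 1) - (a + b * p) / (p * q - 1)
      = N + (a + -((2 + b) * p + (2 + a) * (p * q)) / (p * q - 1)) := by
    field_simp
    ring
  rw [setIntegral_annulus_eq _ hR, hscale, hexp, Real.rpow_add hR, Real.rpow_add hR,
    Real.rpow_natCast]
  have key := le_mul_rpow_of_le_of_le hp hpq hκ hκ' hK hR hF hFG hGF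
  exact (mul_le_mul_of_nonneg_left (mul_le_mul_of_nonneg_left key (by positivity))
    (by positivity)).trans_eq (by ring)

end Estimates

/-- Lemma 2.4: basic integral estimates on annuli for positive solutions of the
Hardy–Hénon system on `ℝ^N`. -/
theorem basic_integral_estimates
    (N : ℕ) (hN : 3 ≤ N) (a b p q : ℝ) (ha : -2 < a) (hb : -2 < b)
    (hp : 0 < p) (hq : 0 < q) (hpq : 1 < p * q) :
    ∃ C > 0, ∀ u v : EuclideanSpace ℝ (Fin N) → ℝ,
      IsHHSol a b p q (univ : Set (EuclideanSpace ℝ (Fin N))) u v →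
      ∀ R > (0 : ℝ),
        (∫ x in {x : EuclideanSpace ℝ (Fin N) | R / 2 < ‖x‖ ∧ ‖x‖ < R}, ‖x‖ ^ a * v x ^ p)
          ≤ C * R ^ ((N : ℝ) - 2 - 2 * (p + 1) / (p * q - 1) - (a + b * p) / (p * q - 1)) ∧
        (∫ x in {x : EuclideanSpace ℝ (Fin N) | R / 2 < ‖x‖ ∧ ‖x‖ < R}, ‖x‖ ^ b * u x ^ q)
          ≤ C * R ^ ((N : ℝ) - 2 - 2 * (q + 1) / (p * q - 1) - (b + a * q) / (p * q - 1)) := by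
  obtain ⟨C₁, hC₁, h₁⟩ := exists_setIntegral_le_mul_rpow hN a b hp hq hpq
  obtain ⟨C₂, hC₂, h₂⟩ := exists_setIntegral_le_mul_rpow hN b a hq hp (by rwa [mul_comm])
  refine ⟨max C₁ C₂, lt_max_of_lt_left hC₁, fun u v h R hR => ⟨(h₁ u v h R hR).trans ?_, ?_⟩⟩
  · gcongr
    exact le_max_left _ _
  · refine (h₂ v u h.swap R hR).trans ?_
    rw [mul_comm q p]
    gcongr
    exact le_max_right _ _
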